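/- Let t ≥ 1 and let f ∈ ∑_{1≤i,j≤t} A(i) ⊗ A(j). For each natural number n > t there exist homogeneous K-subspaces G₁ ⊆ A(n) ⊗ (∑_{i : n/(2t) ≤ i ≤ n} A(i)) and G₂ ⊆ (∑_{i : n/(2t) ≤ i ≤ n} A(i)) ⊗ A(n) with dim_K G₁ ≤ 2^{2t+6}·n²·t³ and dim_K G₂ ≤ 2^{2t+6}·n²·t³ such that, for every integer m ≥ n+1, f^m belongs to the right ideal of A ⊗_K A generated by the set of all products h·g·f^{m−n−1} with h ∈ G₁ ∪ G₂ and g ∈ ∑_{0≤i,j≤t} A(i) ⊗ A(j). -/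

import Mathlib

open TensorProduct

noncomputable section

/-- The free associative unital `K`-algebra on two generators `x, y`. -/
abbrev FA (K : Type) [Field K] : Type := FreeAlgebra K (Fin 2)

/-- `gp K n` is `A(n)`, the span of the words of length `n` in the two generators. -/
def gp (K : Type) [Field K] (n : ℕ) : Submodule K (FA K) :=
  Submodule.span K {a : FA K | ∃ w : List (Fin 2), w.length = n ∧ a = (w.map (FreeAlgebra.ι K)).prod}

/-- The canonical image of `U ⊗[K] V` inside `A ⊗[K] A`. -/
def tp (K : Type) [Field K] (U V : Submodule K (FA K)) : Submodule K (FA K ⊗[K] FA K) :=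
  Submodule.map₂ (TensorProduct.mk K (FA K) (FA K)) U V

/-- `∑_{i : n/(2t) ≤ i ≤ n} A(i)` (the condition `n/(2t) ≤ i` is encoded as `n ≤ 2ti`). -/
def midGp'' (K : Type) [Field K] (t n : ℕ) : Submodule K (FA K) :=
  ⨆ i ∈ {i : ℕ | n ≤ 2 * t * i ∧ i ≤ n}, gp K i

/-- `∑_{0 ≤ i, j ≤ t} A(i) ⊗ A(j)`. -/
def Hsp (K : Type) [Field K] (t : ℕ) : Submodule K (FA K ⊗[K] FA K) :=
  ⨆ i ∈ Finset.Iic t, ⨆ j ∈ Finset.Iic t, tp K (gp K i) (gp K j)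

/-- A subspace of `A ⊗[K] A` is homogeneous if it is spanned by elements lying in
subspaces of the form `A(i) ⊗ A(j)`. -/
def IsHomog (K : Type) [Field K] (S : Submodule K (FA K ⊗[K] FA K)) : Prop :=
  ∃ B : Set (FA K ⊗[K] FA K),
    (∀ x ∈ B, ∃ i j : ℕ, x ∈ tp K (gp K i) (gp K j)) ∧ S = Submodule.span K B

/-- The right ideal of `A ⊗[K] A` generated by a set `X`: the span of `X·(A ⊗ A)`. -/
def rIdeal (K : Type) [Field K] (X : Set (FA K ⊗[K] FA K)) :
    Submodule K (FA K ⊗[K] FA K) :=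
  Submodule.span K X * ⊤

/-- The contribution to bidegree `p` of all `k`-fold products of the pieces `F q` (`q ∈ Q`) whose
proper initial products all have bidegree in `B`. -/
def truncPow {R : Type*} [Semiring R] (B Q : Finset (ℕ × ℕ)) (F : ℕ × ℕ → R) : ℕ → ℕ × ℕ → R
  | 0, p => if p = 0 then 1 else 0
  | k + 1, p => ∑ p' ∈ B, ∑ q ∈ Q, if p' + q = p then truncPow B Q F k p' * F q else 0

/-- The products of `k + 1` pieces that leave the region `B` exactly at the last step. -/
def exitPow {R : Type*} [Semiring R] (B Q : Finset (ℕ × ℕ)) (F : ℕ × ℕ → R) (k : ℕ) : R :=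
  ∑ p ∈ B, ∑ q ∈ Q, if p + q ∈ B then 0 else truncPow B Q F k p * F q

theorem sum_truncPow_mul {R : Type*} [Semiring R] (B Q : Finset (ℕ × ℕ)) (F : ℕ × ℕ → R) (k : ℕ) :
    (∑ p ∈ B, truncPow B Q F k p) * ∑ q ∈ Q, F q =
      ∑ p ∈ B, truncPow B Q F (k + 1) p + exitPow B Q F k := by
  have h : ∑ p ∈ B, truncPow B Q F (k + 1) p =
      ∑ p ∈ B, ∑ q ∈ Q, if p + q ∈ B then truncPow B Q F k p * F q else 0 := by
    simp only [truncPow]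
    rw [Finset.sum_comm]
    refine Finset.sum_congr rfl fun p _ => ?_
    rw [Finset.sum_comm]
    exact Finset.sum_congr rfl fun q _ => Finset.sum_ite_eq _ _ _
  rw [h, exitPow, ← Finset.sum_add_distrib, Finset.sum_mul]
  refine Finset.sum_congr rfl fun p _ => ?_
  rw [← Finset.sum_add_distrib, Finset.mul_sum]
  refine Finset.sum_congr rfl fun q _ => ?_
  split_ifs <;> simp

theorem pow_eq_sum_truncPow_add {R : Type*} [Semiring R] (B Q : Finset (ℕ × ℕ)) (F : ℕ × ℕ → R)
    (hB : 0 ∈ B) (k : ℕ) :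
    (∑ q ∈ Q, F q) ^ k = ∑ p ∈ B, truncPow B Q F k p +
      ∑ l ∈ Finset.range k, exitPow B Q F l * (∑ q ∈ Q, F q) ^ (k - 1 - l) := by
  induction k with
  | zero => simp [truncPow, hB]
  | succ k ih =>
    rw [pow_succ, ih, add_mul, sum_truncPow_mul, Finset.sum_range_succ, Finset.sum_mul]
    simp only [Nat.add_sub_cancel, Nat.sub_self, pow_zero, mul_one]
    rw [add_assoc, add_comm (exitPow B Q F k)]
    congr 2
    refine Finset.sum_congr rfl fun l hl => ?_
    have := Finset.mem_range.1 hl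
    rw [mul_assoc, ← pow_succ]
    congr 2
    omega

theorem truncPow_bounds {R : Type*} [Semiring R] (B : Finset (ℕ × ℕ)) (F : ℕ × ℕ → R) (t k : ℕ)
    (p : ℕ × ℕ)
    (h : truncPow B (Finset.Icc 1 t ×ˢ Finset.Icc 1 t) F k p ≠ 0) :
    k ≤ p.1 ∧ k ≤ p.2 ∧ p.1 ≤ t * k ∧ p.2 ≤ t * k := by
  induction k generalizing p with
  | zero =>
    have : p = 0 := by
      by_contra hp
      simp [truncPow, hp] at h
    simp [this]
  | succ k ih =>
    obtain ⟨p', -, h⟩ := Finset.exists_ne_zero_of_sum_ne_zero h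
    obtain ⟨q, hq, h⟩ := Finset.exists_ne_zero_of_sum_ne_zero h
    have hpq : p' + q = p := by
      by_contra hpq
      exact h (if_neg hpq)
    rw [if_pos hpq] at h
    have := ih p' (left_ne_zero_of_mul h)
    simp only [Finset.mem_product, Finset.mem_Icc] at hq
    subst hpq
    simp only [Prod.fst_add, Prod.snd_add, mul_add, mul_one]
    omega

theorem prod_map_mem_gp (K : Type) [Field K] (w : List (Fin 2)) :
    (w.map (FreeAlgebra.ι K)).prod ∈ gp K w.length :=
  Submodule.subset_span ⟨w, rfl, rfl⟩

theorem tmul_mem_tp (K : Type) [Field K] {U V : Submodule K (FA K)} {u v : FA K} (hu : u ∈ U)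
    (hv : v ∈ V) : u ⊗ₜ[K] v ∈ tp K U V :=
  Submodule.apply_mem_map₂ _ hu hv

theorem tp_gp_le_iff (K : Type) [Field K] {i j : ℕ} {N : Submodule K (FA K ⊗[K] FA K)} :
    tp K (gp K i) (gp K j) ≤ N ↔ ∀ v w : List (Fin 2), v.length = i → w.length = j →
      (v.map (FreeAlgebra.ι K)).prod ⊗ₜ[K] (w.map (FreeAlgebra.ι K)).prod ∈ N := by
  rw [tp, gp, gp, Submodule.map₂_span_span, Submodule.span_le]
  refine ⟨fun h v w hv hw => h ⟨_, ⟨v, hv, rfl⟩, _, ⟨w, hw, rfl⟩, rfl⟩, fun h => ?_⟩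
  rintro _ ⟨_, ⟨v, hv, rfl⟩, _, ⟨w, hw, rfl⟩, rfl⟩
  exact h v w hv hw

theorem tp_gp_mul_le (K : Type) [Field K] (p q : ℕ × ℕ) :
    tp K (gp K p.1) (gp K p.2) * tp K (gp K q.1) (gp K q.2) ≤
      tp K (gp K (p + q).1) (gp K (p + q).2) := by
  rw [Submodule.mul_le]
  intro x hx y hy
  suffices h : tp K (gp K p.1) (gp K p.2) ≤
      (tp K (gp K (p + q).1) (gp K (p + q).2)).comap (LinearMap.mulRight K y) from h hx
  refine (tp_gp_le_iff K).2 fun v w hv hw => ?_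
  suffices h : tp K (gp K q.1) (gp K q.2) ≤ (tp K (gp K (p + q).1) (gp K (p + q).2)).comap
      (LinearMap.mulLeft K ((v.map (FreeAlgebra.ι K)).prod ⊗ₜ (w.map (FreeAlgebra.ι K)).prod))
    from h hy
  refine (tp_gp_le_iff K).2 fun v' w' hv' hw' => ?_
  have h := tmul_mem_tp K (prod_map_mem_gp K (v ++ v')) (prod_map_mem_gp K (w ++ w'))
  simpa [hv, hw, hv', hw'] using h

theorem truncPow_mem_tp (K : Type) [Field K] (B Q : Finset (ℕ × ℕ))
    (F : ℕ × ℕ → FA K ⊗[K] FA K) (hF : ∀ q, F q ∈ tp K (gp K q.1) (gp K q.2)) (k : ℕ)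
    (p : ℕ × ℕ) : truncPow B Q F k p ∈ tp K (gp K p.1) (gp K p.2) := by
  induction k generalizing p with
  | zero =>
    rw [truncPow]
    split_ifs with h
    · subst h
      exact tmul_mem_tp K (prod_map_mem_gp K []) (prod_map_mem_gp K [])
    · exact zero_mem _
  | succ k ih =>
    refine sum_mem fun p' _ => sum_mem fun q _ => ?_
    split_ifs with h
    · subst h
      exact tp_gp_mul_le K p' q (Submodule.mul_mem_mul (ih p') (hF q))
    · exact zero_mem _

theorem tp_le_Hsp (K : Type) [Field K] {t i j : ℕ} (hi : i ≤ t) (hj : j ≤ t) :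
    tp K (gp K i) (gp K j) ≤ Hsp K t :=
  le_iSup₂_of_le i (Finset.mem_Iic.2 hi) (le_iSup₂_of_le j (Finset.mem_Iic.2 hj) le_rfl)

theorem gp_le_midGp'' (K : Type) [Field K] {t n i : ℕ} (h : n ≤ 2 * t * i) (hi : i ≤ n) :
    gp K i ≤ midGp'' K t n :=
  le_iSup₂_of_le i (⟨h, hi⟩ : i ∈ {i : ℕ | n ≤ 2 * t * i ∧ i ≤ n}) le_rfl

theorem tp_mono (K : Type) [Field K] {U U' V V' : Submodule K (FA K)} (hU : U ≤ U')
    (hV : V ≤ V') : tp K U V ≤ tp K U' V' :=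
  Submodule.map₂_le_map₂ hU hV

theorem exists_sum_eq_of_mem (K : Type) [Field K] (s : Finset ℕ) {f : FA K ⊗[K] FA K}
    (hf : f ∈ ⨆ i ∈ s, ⨆ j ∈ s, tp K (gp K i) (gp K j)) :
    ∃ F : ℕ × ℕ → FA K ⊗[K] FA K, (∀ q, F q ∈ tp K (gp K q.1) (gp K q.2)) ∧
      f = ∑ q ∈ s ×ˢ s, F q := by
  obtain ⟨μ, rfl⟩ := (Submodule.mem_iSup_finset_iff_exists_sum _ _).1 hf
  choose ν hν using fun i => (Submodule.mem_iSup_finset_iff_exists_sum _ _).1 (μ i).2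
  refine ⟨fun q => ν q.1 q.2, fun q => (ν q.1 q.2).2, ?_⟩
  rw [Finset.sum_product]
  exact Finset.sum_congr rfl fun i _ => (hν i).symm

/-- The word of length `l + 1` cut out of `v`. -/
def headWord {t : ℕ} (l : Fin t) (v : Fin t → Fin 2) : List (Fin 2) :=
  (List.ofFn v).take (l + 1)

theorem length_headWord {t : ℕ} (l : Fin t) (v : Fin t → Fin 2) :
    (headWord l v).length = l + 1 := by
  have := l.2
  simp only [headWord, List.length_take, List.length_ofFn]
  omega

theorem exists_headWord_eq {t : ℕ} (u : List (Fin 2)) (l : Fin t) (hu : u.length = l + 1) :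
    ∃ v, headWord l v = u := by
  refine ⟨fun i => u.getD i 0, ?_⟩
  refine List.ext_getElem (by rw [length_headWord, hu]) fun i h₁ h₂ => ?_
  simp [headWord, h₂]

/-- Generators of the finite-dimensional space of left factors: `c k b l` times a word of length
`l + 1` put into the tensor square by `e`, when `b` is at least `n / (2t)`. -/
def headGen (K : Type) [Field K] (t n : ℕ) (e : FA K → FA K ⊗[K] FA K)
    (c : ℕ → ℕ → ℕ → FA K ⊗[K] FA K) (x : Fin n × Fin n × Fin t × (Fin t → Fin 2)) :
    FA K ⊗[K] FA K :=
  if n ≤ 2 * t * x.2.1 then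
    c x.1 x.2.1 x.2.2.1 * e (((headWord x.2.2.1 x.2.2.2).map (FreeAlgebra.ι K)).prod) else 0

theorem finrank_span_headGen_le (K : Type) [Field K] {t n : ℕ} (ht : 1 ≤ t)
    (e : FA K → FA K ⊗[K] FA K) (c : ℕ → ℕ → ℕ → FA K ⊗[K] FA K) :
    Module.finrank K (Submodule.span K (Set.range (headGen K t n e c))) ≤
      2 ^ (2 * t + 6) * n ^ 2 * t ^ 3 := by
  refine (finrank_range_le_card (R := K) (headGen K t n e c)).trans ?_
  simp only [Fintype.card_prod, Fintype.card_fin, Fintype.card_fun]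
  calc n * (n * (t * 2 ^ t)) = 2 ^ t * n ^ 2 * t ^ 1 := by ring
    _ ≤ 2 ^ (2 * t + 6) * n ^ 2 * t ^ 3 := by gcongr <;> omega

theorem headGen_mem_span (K : Type) [Field K] {t n : ℕ} (e : FA K → FA K ⊗[K] FA K)
    (c : ℕ → ℕ → ℕ → FA K ⊗[K] FA K) {k b l : ℕ} (hk : k < n) (hb : b < n) (hl : l < t)
    (hbt : n ≤ 2 * t * b) (u : List (Fin 2)) (hu : u.length = l + 1) :
    c k b l * e ((u.map (FreeAlgebra.ι K)).prod) ∈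
      Submodule.span K (Set.range (headGen K t n e c)) := by
  obtain ⟨v, rfl⟩ := exists_headWord_eq u ⟨l, hl⟩ hu
  exact Submodule.subset_span ⟨(⟨k, hk⟩, ⟨b, hb⟩, ⟨l, hl⟩, v), if_pos hbt⟩

theorem mul_mem_of_left_split (K : Type) [Field K] {t i j l : ℕ} (hl : l + 1 ≤ i) (hi : i ≤ t)
    (hj : j ≤ t) (a : FA K ⊗[K] FA K) (G M : Submodule K (FA K ⊗[K] FA K))
    (φ : FA K ⊗[K] FA K →ₗ[K] FA K ⊗[K] FA K)
    (hG : ∀ u : List (Fin 2), u.length = l + 1 → a * ((u.map (FreeAlgebra.ι K)).prod ⊗ₜ 1) ∈ G)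
    (hM : ∀ h ∈ G, ∀ g ∈ Hsp K t, φ (h * g) ∈ M)
    {x : FA K ⊗[K] FA K} (hx : x ∈ tp K (gp K i) (gp K j)) : φ (a * x) ∈ M := by
  suffices h : tp K (gp K i) (gp K j) ≤ M.comap (φ ∘ₗ LinearMap.mulLeft K a) from h hx
  refine (tp_gp_le_iff K).2 fun w v hw hv => ?_
  have h := hM _ (hG (w.take (l + 1)) (by simp; omega)) _ (tp_le_Hsp K (i := i - (l + 1)) (by omega)
    hj (tmul_mem_tp K (u := ((w.drop (l + 1)).map (FreeAlgebra.ι K)).prod)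
      (by simpa [hw] using prod_map_mem_gp K (w.drop (l + 1))) (hv ▸ prod_map_mem_gp K v)))
  rwa [mul_assoc, Algebra.TensorProduct.tmul_mul_tmul, one_mul, ← List.prod_append,
    ← List.map_append, List.take_append_drop] at h

theorem mul_mem_of_right_split (K : Type) [Field K] {t i j l : ℕ} (hl : l + 1 ≤ j) (hi : i ≤ t)
    (hj : j ≤ t) (a : FA K ⊗[K] FA K) (G M : Submodule K (FA K ⊗[K] FA K))
    (φ : FA K ⊗[K] FA K →ₗ[K] FA K ⊗[K] FA K)
    (hG : ∀ u : List (Fin 2), u.length = l + 1 → a * (1 ⊗ₜ (u.map (FreeAlgebra.ι K)).prod) ∈ G)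
    (hM : ∀ h ∈ G, ∀ g ∈ Hsp K t, φ (h * g) ∈ M)
    {x : FA K ⊗[K] FA K} (hx : x ∈ tp K (gp K i) (gp K j)) : φ (a * x) ∈ M := by
  suffices h : tp K (gp K i) (gp K j) ≤ M.comap (φ ∘ₗ LinearMap.mulLeft K a) from h hx
  refine (tp_gp_le_iff K).2 fun v w hv hw => ?_
  have h := hM _ (hG (w.take (l + 1)) (by simp; omega)) _ (tp_le_Hsp K (j := j - (l + 1)) hi
    (by omega) (tmul_mem_tp K (hv ▸ prod_map_mem_gp K v)
      (v := ((w.drop (l + 1)).map (FreeAlgebra.ι K)).prod)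
      (by simpa [hw] using prod_map_mem_gp K (w.drop (l + 1)))))
  rwa [mul_assoc, Algebra.TensorProduct.tmul_mul_tmul, one_mul, ← List.prod_append,
    ← List.map_append, List.take_append_drop] at h

theorem left_headGen_mem (K : Type) [Field K] {t n : ℕ} (hn : t < n)
    (c : ℕ → ℕ → ℕ → FA K ⊗[K] FA K)
    (hc : ∀ k b l, c k b l ∈ tp K (gp K (n - (l + 1))) (gp K b))
    (x : Fin n × Fin n × Fin t × (Fin t → Fin 2)) :
    ∃ i, n ≤ 2 * t * i ∧ i ≤ n ∧ headGen K t n (· ⊗ₜ 1) c x ∈ tp K (gp K n) (gp K i) := by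
  obtain ⟨k, b, l, v⟩ := x
  by_cases hb : n ≤ 2 * t * b
  · refine ⟨b, hb, b.2.le, ?_⟩
    have h := tp_gp_mul_le K (n - (l + 1), b) (l + 1, 0) (Submodule.mul_mem_mul (hc k b l)
      (tmul_mem_tp K (length_headWord l v ▸ prod_map_mem_gp K (headWord l v))
        (prod_map_mem_gp K [])))
    have hl : n - (l + 1) + (l + 1) = n := by omega
    simpa [headGen, hb, hl] using h
  · refine ⟨n, ?_, le_rfl, ?_⟩
    · have := l.2
      nlinarith
    · simp [headGen, hb]

theorem right_headGen_mem (K : Type) [Field K] {t n : ℕ} (hn : t < n)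
    (c : ℕ → ℕ → ℕ → FA K ⊗[K] FA K)
    (hc : ∀ k b l, c k b l ∈ tp K (gp K b) (gp K (n - (l + 1))))
    (x : Fin n × Fin n × Fin t × (Fin t → Fin 2)) :
    ∃ i, n ≤ 2 * t * i ∧ i ≤ n ∧ headGen K t n (1 ⊗ₜ ·) c x ∈ tp K (gp K i) (gp K n) := by
  obtain ⟨k, b, l, v⟩ := x
  by_cases hb : n ≤ 2 * t * b
  · refine ⟨b, hb, b.2.le, ?_⟩
    have h := tp_gp_mul_le K (b, n - (l + 1)) (0, l + 1) (Submodule.mul_mem_mul (hc k b l)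
      (tmul_mem_tp K (prod_map_mem_gp K [])
        (length_headWord l v ▸ prod_map_mem_gp K (headWord l v))))
    have hl : n - (l + 1) + (l + 1) = n := by omega
    simpa [headGen, hb, hl] using h
  · refine ⟨n, ?_, le_rfl, ?_⟩
    · have := l.2
      nlinarith
    · simp [headGen, hb]

theorem pow_eq_sum_exitPow_mul {R : Type*} [Semiring R] {t n m : ℕ} (hn : 0 < n) (hm : n + 1 ≤ m)
    (F : ℕ × ℕ → R) {B Q : Finset (ℕ × ℕ)} (hB : B = Finset.range n ×ˢ Finset.range n)
    (hQ : Q = Finset.Icc 1 t ×ˢ Finset.Icc 1 t) :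
    (∑ q ∈ Q, F q) ^ m = ∑ k ∈ Finset.range n,
      exitPow B Q F k * (∑ q ∈ Q, F q) ^ (m - n - 1) * (∑ q ∈ Q, F q) ^ (n - k) := by
  have hzero : ∑ p ∈ B, truncPow B Q F n p = 0 := by
    refine Finset.sum_eq_zero fun p hp => ?_
    by_contra h
    have := truncPow_bounds B F t n p (hQ ▸ h)
    simp only [hB, Finset.mem_product, Finset.mem_range] at hp
    omega
  have hpow := pow_eq_sum_truncPow_add B Q F (by simp [hB]; omega) n
  rw [hzero, zero_add] at hpow
  obtain ⟨d, rfl⟩ : ∃ d, m = n + (d + 1) := ⟨m - n - 1, by omega⟩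
  rw [pow_add, hpow, Finset.sum_mul]
  refine Finset.sum_congr rfl fun k hk => ?_
  have := Finset.mem_range.1 hk
  rw [mul_assoc, mul_assoc, ← pow_add, ← pow_add]
  congr 2
  omega

theorem truncPow_mul_mem (K : Type) [Field K] {t n k : ℕ} (hn : t < n)
    (F : ℕ × ℕ → FA K ⊗[K] FA K) (hF : ∀ q, F q ∈ tp K (gp K q.1) (gp K q.2))
    {B Q : Finset (ℕ × ℕ)} (hB : B = Finset.range n ×ˢ Finset.range n)
    (hQ : Q = Finset.Icc 1 t ×ˢ Finset.Icc 1 t) (G₁ G₂ M : Submodule K (FA K ⊗[K] FA K))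
    (hG₁ : G₁ = Submodule.span K (Set.range (headGen K t n (· ⊗ₜ 1)
      fun k b l => truncPow B Q F k (n - (l + 1), b))))
    (hG₂ : G₂ = Submodule.span K (Set.range (headGen K t n (1 ⊗ₜ ·)
      fun k b l => truncPow B Q F k (b, n - (l + 1)))))
    (φ : FA K ⊗[K] FA K →ₗ[K] FA K ⊗[K] FA K)
    (hM : ∀ h, (h ∈ G₁ ∨ h ∈ G₂) → ∀ g ∈ Hsp K t, φ (h * g) ∈ M) (hk : k < n)
    {p q : ℕ × ℕ} (hp : p ∈ B) (hq : q ∈ Q) (hpq : p + q ∉ B) :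
    φ (truncPow B Q F k p * F q) ∈ M := by
  by_cases hne : truncPow B Q F k p = 0
  · simp [hne]
  have hbd := truncPow_bounds B F t k p (hQ ▸ hne)
  obtain ⟨a, b⟩ := p
  obtain ⟨i, j⟩ := q
  simp only [hB, hQ, Finset.mem_product, Finset.mem_range, Finset.mem_Icc, Prod.mk_add_mk]
    at hp hq hpq hbd
  have htk : n ≤ a + i ∨ n ≤ b + j → n ≤ 2 * (t * k) := by
    have hk0 : k ≠ 0 := by
      rintro rfl
      omega
    have : t ≤ t * k := Nat.le_mul_of_pos_right t (Nat.pos_of_ne_zero hk0)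
    omega
  by_cases ha : n ≤ a + i
  · obtain ⟨l, hl⟩ : ∃ l, a + (l + 1) = n := ⟨n - a - 1, by omega⟩
    refine mul_mem_of_left_split K (l := l) (by omega) hq.1.2 hq.2.2 _ _ _
      φ (fun u hu => ?_)
      (fun h hh => hM h (Or.inl hh)) (hF (i, j))
    have := headGen_mem_span K (t := t) (· ⊗ₜ 1)
      (fun k b l => truncPow B Q F k (n - (l + 1), b)) hk hp.2 (l := l) (by omega)
      (by nlinarith [htk (Or.inl ha)]) u hu
    rwa [← hG₁, show n - (l + 1) = a by omega] at this
  · have hb : n ≤ b + j := by omega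
    obtain ⟨l, hl⟩ : ∃ l, b + (l + 1) = n := ⟨n - b - 1, by omega⟩
    refine mul_mem_of_right_split K (l := l) (by omega) hq.1.2 hq.2.2 _ _ _
      φ (fun u hu => ?_)
      (fun h hh => hM h (Or.inr hh)) (hF (i, j))
    have := headGen_mem_span K (t := t) (1 ⊗ₜ ·)
      (fun k b l => truncPow B Q F k (b, n - (l + 1))) hk hp.1 (l := l) (by omega)
      (by nlinarith [htk (Or.inr hb)]) u hu
    rwa [← hG₂, show n - (l + 1) = b by omega] at this

theorem statement15 (K : Type) [Field K] (t : ℕ) (ht : 1 ≤ t)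
    (f : FA K ⊗[K] FA K)
    (hf : f ∈ ⨆ i ∈ Finset.Icc 1 t, ⨆ j ∈ Finset.Icc 1 t, tp K (gp K i) (gp K j))
    (n : ℕ) (hn : t < n) :
    ∃ G₁ G₂ : Submodule K (FA K ⊗[K] FA K),
      G₁ ≤ tp K (gp K n) (midGp'' K t n) ∧
      G₂ ≤ tp K (midGp'' K t n) (gp K n) ∧
      IsHomog K G₁ ∧ IsHomog K G₂ ∧
      Module.finrank K G₁ ≤ 2 ^ (2 * t + 6) * n ^ 2 * t ^ 3 ∧
      Module.finrank K G₂ ≤ 2 ^ (2 * t + 6) * n ^ 2 * t ^ 3 ∧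
      ∀ m : ℕ, n + 1 ≤ m →
        f ^ m ∈ rIdeal K
          {z | ∃ h, (h ∈ G₁ ∨ h ∈ G₂) ∧ ∃ g ∈ Hsp K t, z = h * g * f ^ (m - n - 1)} := by
  obtain ⟨F, hF, rfl⟩ := exists_sum_eq_of_mem K _ hf
  set Q := Finset.Icc 1 t ×ˢ Finset.Icc 1 t with hQ
  set B := Finset.range n ×ˢ Finset.range n with hB
  have hP := truncPow_mem_tp K B Q F hF
  have h₁ := left_headGen_mem K hn (fun k b l => truncPow B Q F k (n - (l + 1), b))
    fun k b l => hP k (n - (l + 1), b)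
  have h₂ := right_headGen_mem K hn (fun k b l => truncPow B Q F k (b, n - (l + 1)))
    fun k b l => hP k (b, n - (l + 1))
  obtain ⟨G₁, hG₁⟩ : ∃ G, G = Submodule.span K (Set.range (headGen K t n (· ⊗ₜ 1)
      fun k b l => truncPow B Q F k (n - (l + 1), b))) := ⟨_, rfl⟩
  obtain ⟨G₂, hG₂⟩ : ∃ G, G = Submodule.span K (Set.range (headGen K t n (1 ⊗ₜ ·)
      fun k b l => truncPow B Q F k (b, n - (l + 1)))) := ⟨_, rfl⟩
  refine ⟨G₁, G₂, ?_, ?_, ⟨_, ?_, hG₁⟩, ⟨_, ?_, hG₂⟩, ?_, ?_, ?_⟩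
  · rw [hG₁, Submodule.span_le]
    rintro _ ⟨x, rfl⟩
    obtain ⟨i, hi, hin, h⟩ := h₁ x
    exact tp_mono K le_rfl (gp_le_midGp'' K hi hin) h
  · rw [hG₂, Submodule.span_le]
    rintro _ ⟨x, rfl⟩
    obtain ⟨i, hi, hin, h⟩ := h₂ x
    exact tp_mono K (gp_le_midGp'' K hi hin) le_rfl h
  · rintro _ ⟨x, rfl⟩
    obtain ⟨i, -, -, h⟩ := h₁ x
    exact ⟨n, i, h⟩
  · rintro _ ⟨x, rfl⟩
    obtain ⟨i, -, -, h⟩ := h₂ x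
    exact ⟨i, n, h⟩
  · rw [hG₁]
    exact finrank_span_headGen_le K ht _ _
  · rw [hG₂]
    exact finrank_span_headGen_le K ht _ _
  intro m hm
  rw [pow_eq_sum_exitPow_mul (by omega) hm F hB hQ, rIdeal]
  refine Submodule.sum_mem _ fun k hk => ?_
  refine Submodule.mul_mem_mul ?_ Submodule.mem_top
  have hk' := Finset.mem_range.1 hk
  rw [exitPow, Finset.sum_mul]
  refine Submodule.sum_mem _ fun p hp => ?_
  rw [Finset.sum_mul]
  refine Submodule.sum_mem _ fun q hq => ?_
  split_ifs with hpq
  · simp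
  refine truncPow_mul_mem K hn F hF hB hQ _ _ _ hG₁ hG₂ (LinearMap.mulRight K _)
    (fun h hh g hg => ?_) hk' hp hq hpq
  exact Submodule.subset_span ⟨h, hh, g, hg, rfl⟩
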